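/- arXiv:2511.03002 — 4 statements merged into one kernel-verified Lean document; each statement's English description precedes it below -/
import Mathlib

section
/- Peak-to-peak error-bounding system (Proposition 2). Suppose λ e'ᵀ P e' + 2 e'ᵀ P (A e' + B_e r') ≤ γ ‖r'‖² for all e' ∈ ℝ^n, r' ∈ ℝ^m, and the block matrix [[γ I_p, C], [Cᵀ, λ P]] is positive semidefinite. Let e : [0,∞) → ℝ^n be differentiable with ė(t) = A e(t) + B_e r(t), and let δ : [0,∞) → ℝ be differentiable with δ̇(t) = −λ δ(t) + γ ‖r(t)‖² and δ(0) = e(0)ᵀ P e(0). Then for all t ≥ 0: (1/(λγ)) ‖C e(t)‖² ≤ e(t)ᵀ P e(t) ≤ δ(t). -/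
open Matrix

/-- Product rule for the dot product of two vector-valued curves. -/
theorem HasDerivAt.dotProduct_curve {ι : Type*} [Fintype ι] {u v : ℝ → ι → ℝ} {u' v' : ι → ℝ}
    {t : ℝ} (hu : HasDerivAt u u' t) (hv : HasDerivAt v v' t) :
    HasDerivAt (fun s => u s ⬝ᵥ v s) (u' ⬝ᵥ v t + u t ⬝ᵥ v') t := by
  have h := HasDerivAt.fun_sum (u := Finset.univ) fun i _ =>
    (hasDerivAt_pi.1 hu i).fun_mul (hasDerivAt_pi.1 hv i)
  simpa only [dotProduct, Finset.sum_add_distrib] using h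

/-- The derivative of a symmetric quadratic form along a differentiable curve. -/
theorem HasDerivAt.quadraticForm_curve {ι : Type*} [Fintype ι] {P : Matrix ι ι ℝ}
    (hP : P.IsSymm) {u : ℝ → ι → ℝ} {u' : ι → ℝ} {t : ℝ} (hu : HasDerivAt u u' t) :
    HasDerivAt (fun s => u s ⬝ᵥ (P *ᵥ u s)) (2 * (u t ⬝ᵥ (P *ᵥ u'))) t := by
  have hPu : HasDerivAt (fun s => P *ᵥ u s) (P *ᵥ u') t :=
    (LinearMap.toContinuousLinearMap P.mulVecLin).hasFDerivAt.comp_hasDerivAt t hu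
  have hsymm : u' ⬝ᵥ (P *ᵥ u t) = u t ⬝ᵥ (P *ᵥ u') := by
    rw [dotProduct_mulVec, ← mulVec_transpose, hP.eq, dotProduct_comm]
  convert hu.dotProduct_curve hPu using 1
  rw [hsymm]
  ring

/-- Comparison principle: if `w' ≥ -c w` on `[0, ∞)` and `w 0 ≥ 0`, then `w ≥ 0` there. -/
theorem nonneg_of_hasDerivAt_ge_neg_mul {w w' : ℝ → ℝ} {c : ℝ}
    (hw : ∀ t, 0 ≤ t → HasDerivAt w (w' t) t) (hw' : ∀ t, 0 ≤ t → -c * w t ≤ w' t)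
    (h0 : 0 ≤ w 0) {t : ℝ} (ht : 0 ≤ t) : 0 ≤ w t := by
  have hd (s : ℝ) (hs : 0 ≤ s) : HasDerivAt (fun s => Real.exp (c * s) * w s)
      (Real.exp (c * s) * (c * w s + w' s)) s := by
    refine ((((hasDerivAt_id' s).const_mul c).exp).fun_mul (hw s hs)).congr_deriv ?_
    ring
  have hmono : MonotoneOn (fun s => Real.exp (c * s) * w s) (Set.Ici 0) := by
    refine monotoneOn_of_deriv_nonneg (convex_Ici 0)
      (fun s hs => (hd s hs).continuousAt.continuousWithinAt)
      (fun s hs => (hd s (interior_subset hs)).differentiableAt.differentiableWithinAt)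
      fun s hs => ?_
    have hs' : 0 ≤ s := interior_subset hs
    rw [(hd s hs').deriv]
    exact mul_nonneg (Real.exp_pos _).le (by linarith [hw' s hs'])
  have h : Real.exp (c * 0) * w 0 ≤ Real.exp (c * t) * w t :=
    hmono Set.self_mem_Ici ht ht
  rw [mul_zero, Real.exp_zero, one_mul] at h
  exact nonneg_of_mul_nonneg_right (h0.trans h) (Real.exp_pos _)

/-- Schur-complement bound extracted from a positive semidefinite block matrix. -/
theorem Matrix.PosSemidef.dotProduct_mulVec_le_of_fromBlocks {ι κ : Type*} [Fintype ι]
    [Fintype κ] [DecidableEq κ] {C : Matrix κ ι ℝ} {Q : Matrix ι ι ℝ} {g : ℝ} (hg : 0 < g)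
    (h : (fromBlocks (g • (1 : Matrix κ κ ℝ)) C Cᵀ Q).PosSemidef) (x : ι → ℝ) :
    g⁻¹ * ((C *ᵥ x) ⬝ᵥ (C *ᵥ x)) ≤ x ⬝ᵥ (Q *ᵥ x) := by
  have hx := h.dotProduct_mulVec_nonneg (Sum.elim (-g⁻¹ • (C *ᵥ x)) x)
  have hC : x ⬝ᵥ (Cᵀ *ᵥ (C *ᵥ x)) = (C *ᵥ x) ⬝ᵥ (C *ᵥ x) := by
    rw [dotProduct_mulVec, vecMul_transpose]
  rw [star_trivial, fromBlocks_mulVec, sumElim_dotProduct_sumElim] at hx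
  simp only [Sum.elim_comp_inl, Sum.elim_comp_inr, smul_mulVec, one_mulVec, mulVec_smul,
    dotProduct_add, smul_dotProduct, dotProduct_smul, smul_eq_mul, hC] at hx
  have hgg : g * (-g⁻¹ * (-g⁻¹ * ((C *ᵥ x) ⬝ᵥ (C *ᵥ x)))) = g⁻¹ * ((C *ᵥ x) ⬝ᵥ (C *ᵥ x)) := by
    field_simp
  linarith

/-- **Peak-to-peak error-bounding system (Proposition 2).**
Suppose `λ e'ᵀ P e' + 2 e'ᵀ P (A e' + Bₑ r') ≤ γ ‖r'‖²` for all `e', r'`, and the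
block matrix `[[γ I, C], [Cᵀ, λ P]]` is positive semidefinite. Let `e` solve
`ė = A e + Bₑ r` and let `δ` solve `δ̇ = −λ δ + γ ‖r‖²` with `δ(0) = e(0)ᵀ P e(0)`.
Then for all `t ≥ 0`: `(1/(λγ)) ‖C e(t)‖² ≤ e(t)ᵀ P e(t) ≤ δ(t)`. -/
theorem peak_error_bounding_system
    {n m p : ℕ}
    (A : Matrix (Fin n) (Fin n) ℝ) (Be : Matrix (Fin n) (Fin m) ℝ)
    (C : Matrix (Fin p) (Fin n) ℝ)
    (P : Matrix (Fin n) (Fin n) ℝ) (hP : P.PosSemidef)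
    (lam gam : ℝ) (hlam : 0 < lam) (hgam : 0 < gam)
    (hdiss : ∀ (e' : Fin n → ℝ) (r' : Fin m → ℝ),
      lam * (e' ⬝ᵥ (P *ᵥ e')) + 2 * (e' ⬝ᵥ (P *ᵥ (A *ᵥ e' + Be *ᵥ r')))
        ≤ gam * (r' ⬝ᵥ r'))
    (hout : (Matrix.fromBlocks
        (gam • (1 : Matrix (Fin p) (Fin p) ℝ)) C Cᵀ (lam • P)).PosSemidef)
    (r : ℝ → Fin m → ℝ) (hr : Continuous r)
    (e : ℝ → Fin n → ℝ)
    (he : ∀ t : ℝ, 0 ≤ t → HasDerivAt e (A *ᵥ e t + Be *ᵥ r t) t)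
    (δ : ℝ → ℝ)
    (hδ : ∀ t : ℝ, 0 ≤ t → HasDerivAt δ (-lam * δ t + gam * (r t ⬝ᵥ r t)) t)
    (hδ0 : δ 0 = e 0 ⬝ᵥ (P *ᵥ e 0)) :
    ∀ t : ℝ, 0 ≤ t →
      (1 / (lam * gam)) * ((C *ᵥ e t) ⬝ᵥ (C *ᵥ e t)) ≤ e t ⬝ᵥ (P *ᵥ e t) ∧
      e t ⬝ᵥ (P *ᵥ e t) ≤ δ t := by
  intro t ht
  constructor
  · have h := hout.dotProduct_mulVec_le_of_fromBlocks hgam (e t)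
    rw [smul_mulVec, dotProduct_smul, smul_eq_mul] at h
    rw [one_div, mul_inv, mul_assoc, inv_mul_le_iff₀ hlam]
    exact h
  · have hsymm : P.IsSymm := by simpa [IsHermitian, IsSymm] using hP.isHermitian
    refine sub_nonneg.1 (nonneg_of_hasDerivAt_ge_neg_mul (c := lam)
      (fun s hs => (hδ s hs).fun_sub ((he s hs).quadraticForm_curve hsymm))
      (fun s _ => ?_) (sub_nonneg.2 hδ0.ge) ht)
    linarith [hdiss (e s) (r s)]
end

section
/- Peak-to-peak gain bound of the error dynamics (second claim of Proposition 2). Suppose λ e'ᵀ P e' + 2 e'ᵀ P (A e' + B_e r') ≤ γ ‖r'‖² for all e' ∈ ℝ^n, r' ∈ ℝ^m, and the block matrix [[γ I_p, C], [Cᵀ, λ P]] is positive semidefinite. Let r : [0,∞) → ℝ^m be continuous with ‖r(t)‖ ≤ R̄ for all t ≥ 0, and let e : [0,∞) → ℝ^n be differentiable with ė(t) = A e(t) + B_e r(t), e(0) = e₀. Then for all t ≥ 0: ‖C e(t)‖² ≤ λ γ exp(−λ t) · e₀ᵀ P e₀ + γ² R̄². In particular, sup_{t≥0} ‖C e(t)‖²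 ≤ γ² · (sup_{t≥0} ‖r(t)‖)² + λ γ · e₀ᵀ P e₀. -/
open Matrix

/-- Product rule for the dot product of two curves. -/
lemma hasDerivAt_dotProduct {ι : Type*} [Fintype ι] {x y : ℝ → ι → ℝ} {x' y' : ι → ℝ} {t : ℝ}
    (hx : HasDerivAt x x' t) (hy : HasDerivAt y y' t) :
    HasDerivAt (fun s => x s ⬝ᵥ y s) (x' ⬝ᵥ y t + x t ⬝ᵥ y') t := by
  rw [hasDerivAt_pi] at hx hy
  simp only [dotProduct, ← Finset.sum_add_distrib]
  exact HasDerivAt.fun_sum fun i _ => (hx i).mul (hy i)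

/-- Differentiation commutes with a constant matrix. -/
lemma hasDerivAt_const_mulVec {ι κ : Type*} [Fintype ι] [Fintype κ] (M : Matrix κ ι ℝ)
    {x : ℝ → ι → ℝ} {x' : ι → ℝ} {t : ℝ} (hx : HasDerivAt x x' t) :
    HasDerivAt (fun s => M *ᵥ x s) (M *ᵥ x') t := by
  rw [hasDerivAt_pi] at hx ⊢
  intro k
  simp only [mulVec, dotProduct]
  exact HasDerivAt.fun_sum fun i _ => (hx i).const_mul (M k i)

/-- Derivative of a quadratic form along a curve. -/
lemma hasDerivAt_quadraticForm {ι : Type*} [Fintype ι] {P : Matrix ι ι ℝ} (hP : Pᵀ = P)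
    {x : ℝ → ι → ℝ} {x' : ι → ℝ} {t : ℝ} (hx : HasDerivAt x x' t) :
    HasDerivAt (fun s => x s ⬝ᵥ (P *ᵥ x s)) (2 * (x t ⬝ᵥ (P *ᵥ x'))) t := by
  convert hasDerivAt_dotProduct hx (hasDerivAt_const_mulVec P hx) using 1
  have hsymm : x' ⬝ᵥ (P *ᵥ x t) = x t ⬝ᵥ (P *ᵥ x') := by
    rw [dotProduct_mulVec, ← mulVec_transpose, hP, dotProduct_comm]
  rw [hsymm]
  ring

/-- Comparison lemma for a linear differential inequality with constant forcing. -/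
lemma le_exp_mul_add_of_deriv_le {V V' : ℝ → ℝ} {lam c : ℝ}
    (hV : ∀ t, 0 ≤ t → HasDerivAt V (V' t) t)
    (hle : ∀ t, 0 ≤ t → V' t + lam * V t ≤ lam * c) {t : ℝ} (ht : 0 ≤ t) :
    V t ≤ Real.exp (-lam * t) * (V 0 - c) + c := by
  have hW : ∀ s, 0 ≤ s → HasDerivAt (fun s => Real.exp (lam * s) * (V s - c))
      (Real.exp (lam * s) * (V' s + lam * V s - lam * c)) s := by
    intro s hs
    have h1 : HasDerivAt (fun s => Real.exp (lam * s)) (Real.exp (lam * s) * (lam * 1)) s :=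
      ((hasDerivAt_id s).const_mul lam).exp
    exact (h1.mul ((hV s hs).sub_const c)).congr_deriv (by ring)
  have hanti : AntitoneOn (fun s => Real.exp (lam * s) * (V s - c)) (Set.Ici 0) := by
    refine antitoneOn_of_hasDerivWithinAt_nonpos (convex_Ici 0)
      (fun s hs => (hW s hs).continuousAt.continuousWithinAt)
      (fun s hs => (hW s (interior_subset hs)).hasDerivWithinAt) fun s hs => ?_
    exact mul_nonpos_of_nonneg_of_nonpos (Real.exp_pos _).le
      (sub_nonpos.2 (hle s (interior_subset hs)))
  have h := hanti (Set.mem_Ici.2 le_rfl) (Set.mem_Ici.2 ht) ht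
  simp only [mul_zero, Real.exp_zero, one_mul] at h
  have h2 := mul_le_mul_of_nonneg_left h (Real.exp_pos (-lam * t)).le
  rw [← mul_assoc, ← Real.exp_add, neg_mul, neg_add_cancel, Real.exp_zero, one_mul] at h2
  rw [neg_mul]
  linarith

/-- Schur complement bound on the output by the storage function. -/
lemma dotProduct_mulVec_self_le_of_fromBlocks_posSemidef {ι κ : Type*} [Fintype ι] [Fintype κ]
    [DecidableEq κ] {C : Matrix κ ι ℝ} {Q : Matrix ι ι ℝ} {gam : ℝ} (hgam : 0 < gam)
    (h : (Matrix.fromBlocks (gam • (1 : Matrix κ κ ℝ)) C Cᵀ Q).PosSemidef) (x : ι → ℝ) :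
    (C *ᵥ x) ⬝ᵥ (C *ᵥ x) ≤ gam * (x ⬝ᵥ (Q *ᵥ x)) := by
  have hq := h.dotProduct_mulVec_nonneg (Sum.elim (C *ᵥ x) (-gam • x))
  have hC : x ⬝ᵥ (Cᵀ *ᵥ (C *ᵥ x)) = (C *ᵥ x) ⬝ᵥ (C *ᵥ x) := by
    rw [dotProduct_mulVec, vecMul_transpose]
  simp only [star_trivial, fromBlocks_mulVec, Sum.elim_comp_inl, Sum.elim_comp_inr,
    sumElim_dotProduct_sumElim, mulVec_smul, smul_mulVec, one_mulVec, dotProduct_add,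
    dotProduct_smul, smul_dotProduct, smul_eq_mul, hC] at hq
  refine le_of_mul_le_mul_left ?_ hgam
  linarith

/-- **Peak-to-peak gain bound of the error dynamics (second claim of Proposition 2).**
Under the dissipation inequality and the output LMI, if `‖r(t)‖ ≤ R̄` for all `t ≥ 0`
and `e` solves `ė = A e + Bₑ r`, `e(0) = e₀`, then for all `t ≥ 0`:
`‖C e(t)‖² ≤ λ γ exp(−λ t) e₀ᵀ P e₀ + γ² R̄²`; in particular the peak of `‖C e‖²` is
bounded by `γ² R̄² + λ γ e₀ᵀ P e₀`. -/
theorem peak_to_peak_gain_bound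
    {n m p : ℕ}
    (A : Matrix (Fin n) (Fin n) ℝ) (Be : Matrix (Fin n) (Fin m) ℝ)
    (C : Matrix (Fin p) (Fin n) ℝ)
    (P : Matrix (Fin n) (Fin n) ℝ) (hP : P.PosSemidef)
    (lam gam : ℝ) (hlam : 0 < lam) (hgam : 0 < gam)
    (hdiss : ∀ (e' : Fin n → ℝ) (r' : Fin m → ℝ),
      lam * (e' ⬝ᵥ (P *ᵥ e')) + 2 * (e' ⬝ᵥ (P *ᵥ (A *ᵥ e' + Be *ᵥ r')))
        ≤ gam * (r' ⬝ᵥ r'))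
    (hout : (Matrix.fromBlocks
        (gam • (1 : Matrix (Fin p) (Fin p) ℝ)) C Cᵀ (lam • P)).PosSemidef)
    (r : ℝ → Fin m → ℝ) (hr : Continuous r)
    (Rbar : ℝ) (hRbar : ∀ t : ℝ, 0 ≤ t → Real.sqrt (r t ⬝ᵥ r t) ≤ Rbar)
    (e₀ : Fin n → ℝ) (e : ℝ → Fin n → ℝ)
    (he : ∀ t : ℝ, 0 ≤ t → HasDerivAt e (A *ᵥ e t + Be *ᵥ r t) t)
    (he0 : e 0 = e₀) :
    (∀ t : ℝ, 0 ≤ t →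
      (C *ᵥ e t) ⬝ᵥ (C *ᵥ e t)
        ≤ lam * gam * Real.exp (-lam * t) * (e₀ ⬝ᵥ (P *ᵥ e₀)) + gam ^ 2 * Rbar ^ 2) ∧
    (∀ t : ℝ, 0 ≤ t →
      (C *ᵥ e t) ⬝ᵥ (C *ᵥ e t)
        ≤ gam ^ 2 * Rbar ^ 2 + lam * gam * (e₀ ⬝ᵥ (P *ᵥ e₀))) := by
  have hV0 : 0 ≤ e₀ ⬝ᵥ (P *ᵥ e₀) := by simpa using hP.dotProduct_mulVec_nonneg e₀
  have hPt : Pᵀ = P := by simpa [conjTranspose_eq_transpose_of_trivial] using hP.isHermitian.eq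
  have hr2 : ∀ t, 0 ≤ t → r t ⬝ᵥ r t ≤ Rbar ^ 2 := fun t ht => by
    have h := hRbar t ht
    exact (Real.sqrt_le_left ((Real.sqrt_nonneg _).trans h)).1 h
  have hbound : ∀ t : ℝ, 0 ≤ t → (C *ᵥ e t) ⬝ᵥ (C *ᵥ e t)
      ≤ lam * gam * Real.exp (-lam * t) * (e₀ ⬝ᵥ (P *ᵥ e₀)) + gam ^ 2 * Rbar ^ 2 := by
    intro t ht
    have hV := le_exp_mul_add_of_deriv_le (c := gam * Rbar ^ 2 / lam) (lam := lam)
      (fun s hs => hasDerivAt_quadraticForm hPt (he s hs)) (fun s hs => by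
        rw [mul_div_cancel₀ _ hlam.ne']
        have h1 := hdiss (e s) (r s)
        have h2 := mul_le_mul_of_nonneg_left (hr2 s hs) hgam.le
        linarith) ht
    rw [he0] at hV
    have hC := dotProduct_mulVec_self_le_of_fromBlocks_posSemidef hgam hout (e t)
    rw [smul_mulVec, dotProduct_smul, smul_eq_mul] at hC
    have hV' := mul_le_mul_of_nonneg_left hV (mul_pos hgam hlam).le
    have hcancel : gam * lam * (gam * Rbar ^ 2 / lam) = gam ^ 2 * Rbar ^ 2 := by
      field_simp
    have hpos : 0 ≤ Real.exp (-lam * t) * (gam ^ 2 * Rbar ^ 2) := by positivity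
    rw [← hcancel] at hpos ⊢
    linarith
  refine ⟨hbound, fun t ht => (hbound t ht).trans ?_⟩
  have hexp : Real.exp (-lam * t) ≤ 1 := Real.exp_le_one_iff.2 (by nlinarith)
  have hmul := mul_le_mul_of_nonneg_left hexp (mul_nonneg (mul_pos hlam hgam).le hV0)
  linarith
end

section
/- Grönwall-type state bound under an α-IQC (step in the proof of Proposition 4). Suppose 2α ξ'ᵀ P ξ' + 2 ξ'ᵀ P (A ξ' + B w') + (C ξ' + D w')ᵀ M (C ξ' + D w') ≤ w'ᵀ Γ w' for all ξ' ∈ ℝ^n, w' ∈ ℝ^m. Let ξ : [0,∞) → ℝ^n be differentiable with ξ̇(t) = A ξ(t) + B w(t), set y(t) := C ξ(t) + D w(t), and assume the α-IQC holds: ∫₀ᵗ exp(2α τ) y(τ)ᵀ M y(τ) dτ + exp(2α t) ξ(t)ᵀ X ξ(t) ≥ 0 for all t ≥ 0. Then for all t ≥ 0: exp(2α t) · ξ(t)ᵀ (P − X) ξ(t) ≤ ξ(0)ᵀ P ξ(0) + ∫₀ᵗ exp(2α τ) w(τ)ᵀ Γ w(τ) dτ. -/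
open Matrix

theorem HasDerivAt.dotProduct_mulVec_self {ι : Type*} [Fintype ι] {P : Matrix ι ι ℝ}
    (hP : P.IsSymm) {x : ℝ → ι → ℝ} {x' : ι → ℝ} {t : ℝ} (hx : HasDerivAt x x' t) :
    HasDerivAt (fun s => x s ⬝ᵥ (P *ᵥ x s)) (2 * (x t ⬝ᵥ (P *ᵥ x'))) t := by
  have hx_apply := hasDerivAt_pi.1 hx
  have hPx : ∀ i, HasDerivAt (fun s => (P *ᵥ x s) i) ((P *ᵥ x') i) t := fun i =>
    HasDerivAt.fun_sum fun j _ => (hx_apply j).const_mul (P i j)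
  have hsymm : x' ⬝ᵥ (P *ᵥ x t) = x t ⬝ᵥ (P *ᵥ x') := by
    rw [dotProduct_mulVec, ← mulVec_transpose, hP.eq, dotProduct_comm]
  have hsum : HasDerivAt (fun s => x s ⬝ᵥ (P *ᵥ x s))
      (∑ i, (x' i * (P *ᵥ x t) i + x t i * (P *ᵥ x') i)) t :=
    HasDerivAt.fun_sum fun i _ => (hx_apply i).mul (hPx i)
  convert hsum using 1
  rw [Finset.sum_add_distrib]
  change _ = x' ⬝ᵥ (P *ᵥ x t) + x t ⬝ᵥ (P *ᵥ x')
  rw [hsymm, two_mul]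

theorem ContinuousOn.matrix_mulVec_const {ι κ : Type*} [Fintype κ] (A : Matrix ι κ ℝ)
    {x : ℝ → κ → ℝ} {s : Set ℝ} (hx : ContinuousOn x s) :
    ContinuousOn (fun t => A *ᵥ x t) s :=
  (Continuous.matrix_mulVec continuous_const continuous_id).comp_continuousOn hx

theorem ContinuousOn.dotProduct_vec {ι : Type*} [Fintype ι] {x z : ℝ → ι → ℝ} {s : Set ℝ}
    (hx : ContinuousOn x s) (hz : ContinuousOn z s) :
    ContinuousOn (fun t => x t ⬝ᵥ z t) s :=
  (Continuous.dotProduct continuous_fst continuous_snd).comp_continuousOn (hx.prodMk hz)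

/-- **Grönwall-type state bound under an α-IQC (step in the proof of Prop. 4).**
Suppose the dissipation inequality
`2α ξ'ᵀPξ' + 2 ξ'ᵀP(Aξ' + Bw') + (Cξ' + Dw')ᵀM(Cξ' + Dw') ≤ w'ᵀΓw'` holds for all
`ξ', w'`. If `ξ` solves `ξ̇ = Aξ + Bw`, `y := Cξ + Dw`, and the α-IQC
`∫₀ᵗ e^{2ατ} yᵀMy dτ + e^{2αt} ξ(t)ᵀXξ(t) ≥ 0` holds for all `t ≥ 0`, then
`e^{2αt} ξ(t)ᵀ(P−X)ξ(t) ≤ ξ(0)ᵀPξ(0) + ∫₀ᵗ e^{2ατ} w(τ)ᵀΓw(τ) dτ` for all `t ≥ 0`. -/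
theorem gronwall_bound_under_alpha_IQC
    {n m q : ℕ}
    (A : Matrix (Fin n) (Fin n) ℝ) (B : Matrix (Fin n) (Fin m) ℝ)
    (C : Matrix (Fin q) (Fin n) ℝ) (D : Matrix (Fin q) (Fin m) ℝ)
    (P X : Matrix (Fin n) (Fin n) ℝ) (hP : P.IsSymm) (hX : X.IsSymm)
    (M : Matrix (Fin q) (Fin q) ℝ) (hM : M.IsSymm)
    (Γ : Matrix (Fin m) (Fin m) ℝ) (hΓ : Γ.IsSymm)
    (α : ℝ) (hα : 0 ≤ α)
    (hdiss : ∀ (ξ' : Fin n → ℝ) (w' : Fin m → ℝ),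
      2 * α * (ξ' ⬝ᵥ (P *ᵥ ξ')) + 2 * (ξ' ⬝ᵥ (P *ᵥ (A *ᵥ ξ' + B *ᵥ w')))
        + (C *ᵥ ξ' + D *ᵥ w') ⬝ᵥ (M *ᵥ (C *ᵥ ξ' + D *ᵥ w'))
        ≤ w' ⬝ᵥ (Γ *ᵥ w'))
    (w : ℝ → Fin m → ℝ) (hw : Continuous w)
    (ξ : ℝ → Fin n → ℝ)
    (hξ : ∀ t : ℝ, 0 ≤ t → HasDerivAt ξ (A *ᵥ ξ t + B *ᵥ w t) t)
    (y : ℝ → Fin q → ℝ) (hy : ∀ t : ℝ, y t = C *ᵥ ξ t + D *ᵥ w t)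
    (hIQC : ∀ t : ℝ, 0 ≤ t →
      0 ≤ (∫ τ in (0 : ℝ)..t, Real.exp (2 * α * τ) * (y τ ⬝ᵥ (M *ᵥ y τ)))
        + Real.exp (2 * α * t) * (ξ t ⬝ᵥ (X *ᵥ ξ t))) :
    ∀ t : ℝ, 0 ≤ t →
      Real.exp (2 * α * t) * (ξ t ⬝ᵥ ((P - X) *ᵥ ξ t))
        ≤ ξ 0 ⬝ᵥ (P *ᵥ ξ 0)
          + ∫ τ in (0 : ℝ)..t, Real.exp (2 * α * τ) * (w τ ⬝ᵥ (Γ *ᵥ w τ)) := by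
  intro t ht
  have hξc : ContinuousOn ξ (Set.uIcc 0 t) := fun s hs =>
    (hξ s (Set.uIcc_of_le ht ▸ hs).1).continuousAt.continuousWithinAt
  have hwc : ContinuousOn w (Set.uIcc 0 t) := hw.continuousOn
  have hyc : ContinuousOn y (Set.uIcc 0 t) := by
    rw [funext hy]
    exact (hξc.matrix_mulVec_const C).add (hwc.matrix_mulVec_const D)
  have hexp : ContinuousOn (fun s => Real.exp (2 * α * s)) (Set.uIcc 0 t) := by fun_prop
  have hsupply : ContinuousOn (fun s => Real.exp (2 * α * s) * (w s ⬝ᵥ (Γ *ᵥ w s)))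
      (Set.uIcc 0 t) := hexp.mul (hwc.dotProduct_vec (hwc.matrix_mulVec_const Γ))
  have houtput : ContinuousOn (fun s => Real.exp (2 * α * s) * (y s ⬝ᵥ (M *ᵥ y s)))
      (Set.uIcc 0 t) := hexp.mul (hyc.dotProduct_vec (hyc.matrix_mulVec_const M))
  let V' : ℝ → ℝ := fun s => Real.exp (2 * α * s) *
    (2 * α * (ξ s ⬝ᵥ (P *ᵥ ξ s)) + 2 * (ξ s ⬝ᵥ (P *ᵥ (A *ᵥ ξ s + B *ᵥ w s))))
  have hV'c : ContinuousOn V' (Set.uIcc 0 t) :=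
    hexp.mul (((hξc.dotProduct_vec (hξc.matrix_mulVec_const P)).const_mul _).add
      ((hξc.dotProduct_vec (((hξc.matrix_mulVec_const A).add
        (hwc.matrix_mulVec_const B)).matrix_mulVec_const P)).const_mul _))
  have hV : ∀ s ∈ Set.uIcc 0 t,
      HasDerivAt (fun s => Real.exp (2 * α * s) * (ξ s ⬝ᵥ (P *ᵥ ξ s))) (V' s) s := by
    intro s hs
    have he : HasDerivAt (fun s => Real.exp (2 * α * s)) (Real.exp (2 * α * s) * (2 * α)) s := by
      simpa using ((hasDerivAt_id s).const_mul (2 * α)).exp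
    refine (he.fun_mul ((hξ s (Set.uIcc_of_le ht ▸ hs).1).dotProduct_mulVec_self hP)).congr_deriv ?_
    dsimp only [V']
    ring
  have hFTC := intervalIntegral.integral_eq_sub_of_hasDerivAt hV hV'c.intervalIntegrable
  have hmono : ∫ s in (0 : ℝ)..t, V' s ≤
      ∫ s in (0 : ℝ)..t, (Real.exp (2 * α * s) * (w s ⬝ᵥ (Γ *ᵥ w s))
        - Real.exp (2 * α * s) * (y s ⬝ᵥ (M *ᵥ y s))) := by
    refine intervalIntegral.integral_mono_on ht hV'c.intervalIntegrable
      (hsupply.sub houtput).intervalIntegrable fun s _ => ?_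
    have hs := hdiss (ξ s) (w s)
    rw [← hy] at hs
    rw [← mul_sub]
    exact mul_le_mul_of_nonneg_left (by linarith) (Real.exp_pos _).le
  rw [intervalIntegral.integral_sub hsupply.intervalIntegrable houtput.intervalIntegrable] at hmono
  simp only [mul_zero, Real.exp_zero, one_mul] at hFTC
  rw [sub_mulVec, dotProduct_sub, mul_sub]
  linarith [hIQC t ht]
end

section
/- Feasibility of the peak-to-peak LMI problem for Hurwitz matrices (claim after Problem (11)). Let A ∈ ℝ^{n×n} be Hurwitz, i.e., every eigenvalue of A (over ℂ) has strictly negative real part. Then for any B_e ∈ ℝ^{n×m} and C ∈ ℝ^{p×n} there exist λ > 0, γ > 0 and a symmetric positive semidefinite P ∈ ℝ^{n×n} such that the block matrix [[λP + AᵀP + PA, P B_e], [B_eᵀ P, −γ I_m]] is negative semidefinite and the block matrix [[γ I_p, C], [Cᵀ, λ P]] is positive semidefinite. -/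
open Matrix Filter Topology

theorem tendsto_pow_zero_of_spectralRadius_lt_one {R : Type*} [NormedRing R] [NormedAlgebra ℂ R]
    [CompleteSpace R] {a : R} (ha : spectralRadius ℂ a < 1) :
    Tendsto (fun k : ℕ => a ^ k) atTop (𝓝 0) := by
  obtain ⟨r, har, hr⟩ := ENNReal.lt_iff_exists_nnreal_btwn.1 ha
  have hr1 : (r : ℝ) < 1 := by exact_mod_cast hr
  refine squeeze_zero_norm' ?_ (tendsto_pow_atTop_nhds_zero_of_lt_one r.coe_nonneg hr1)
  filter_upwards [(spectrum.pow_nnnorm_pow_one_div_tendsto_nhds_spectralRadius a).eventually_lt_const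
    har, eventually_ne_atTop 0] with k hk hk0
  rw [one_div, ENNReal.rpow_inv_lt_iff (by positivity), ENNReal.rpow_natCast] at hk
  exact_mod_cast hk.le

theorem Complex.exists_pos_norm_one_add_mul_lt_one {s : Set ℂ} (hs : s.Finite)
    (hneg : ∀ μ ∈ s, μ.re < 0) : ∃ h : ℝ, 0 < h ∧ ∀ μ ∈ s, ‖1 + h * μ‖ < 1 := by
  have key : ∀ μ ∈ s, ∀ᶠ h : ℝ in 𝓝[>] 0, ‖1 + h * μ‖ < 1 := by
    intro μ hμ
    have hlim : Tendsto (fun h : ℝ => 2 * μ.re + h * normSq μ) (𝓝[>] 0) (𝓝 (2 * μ.re)) := by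
      have : Continuous fun h : ℝ => 2 * μ.re + h * normSq μ := by fun_prop
      simpa using (this.tendsto 0).mono_left nhdsWithin_le_nhds
    filter_upwards [hlim.eventually_lt_const (show 2 * μ.re < 0 by linarith [hneg μ hμ]),
      self_mem_nhdsWithin] with h hh hpos
    rw [← sq_lt_one_iff₀ (norm_nonneg _), Complex.sq_norm]
    have := mul_neg_of_pos_of_neg (show 0 < h from hpos) hh
    simp only [normSq_apply, add_re, add_im, one_re, one_im, re_ofReal_mul, im_ofReal_mul] at this ⊢
    linarith
  obtain ⟨h, hs', hpos⟩ := (((eventually_all_finite hs).2 key).and self_mem_nhdsWithin).exists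
  exact ⟨h, hpos, hs'⟩

namespace Matrix

variable {ι κ : Type*} [Fintype ι] [Fintype κ]

section Operator

open scoped Matrix.Norms.Operator

theorem tendsto_pow_zero_of_forall_spectrum_norm_lt_one [DecidableEq ι] (B : Matrix ι ι ℂ)
    (hB : ∀ μ ∈ spectrum ℂ B, ‖μ‖ < 1) : Tendsto (fun k : ℕ => B ^ k) atTop (𝓝 0) := by
  cases isEmpty_or_nonempty ι
  · simp [Subsingleton.elim _ (0 : Matrix ι ι ℂ)]
  · apply tendsto_pow_zero_of_spectralRadius_lt_one
    exact_mod_cast spectrum.spectralRadius_lt_of_forall_lt B (r := 1) fun μ hμ => by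
      exact_mod_cast hB μ hμ

end Operator

theorem exists_pos_tendsto_one_add_smul_pow [DecidableEq ι] (A : Matrix ι ι ℝ)
    (hA : ∀ μ ∈ spectrum ℂ (A.map (Complex.ofReal : ℝ → ℂ)), μ.re < 0) :
    ∃ h : ℝ, 0 < h ∧ Tendsto (fun k : ℕ => (1 + h • A) ^ k) atTop (𝓝 0) := by
  obtain ⟨h, hpos, hh⟩ := Complex.exists_pos_norm_one_add_mul_lt_one (finite_spectrum _) hA
  refine ⟨h, hpos, ?_⟩
  have hmap (k : ℕ) : ((1 + h • A) ^ k).map Complex.ofReal =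
      (1 + (h : ℂ) • A.map Complex.ofReal) ^ k := by
    have h1 := map_pow (Complex.ofRealHom.mapMatrix (m := ι)) (1 + h • A) k
    have h2 : Complex.ofRealHom.mapMatrix (h • A) = (h : ℂ) • A.map Complex.ofReal := by
      ext i j
      simp
    rwa [map_add, map_one, h2] at h1
  have hlim := tendsto_pow_zero_of_forall_spectrum_norm_lt_one
    (1 + (h : ℂ) • A.map Complex.ofReal) (by
      intro μ hμ
      have hu : IsUnit (h : ℂ) := by simpa using hpos.ne'
      rw [← map_one (algebraMap ℂ (Matrix ι ι ℂ)), ← spectrum.singleton_add_eq,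
        ← hu.unit_spec, ← Units.smul_def, spectrum.unit_smul_eq_smul] at hμ
      obtain ⟨_, rfl, _, ⟨ν, hν, rfl⟩, rfl⟩ := hμ
      exact hh ν hν)
  simp only [← hmap] at hlim
  have hre : Continuous fun M : Matrix ι ι ℂ => M.map Complex.re :=
    continuous_id.matrix_map Complex.continuous_re
  simpa [Function.comp_def, Matrix.map_map] using (hre.tendsto 0).comp hlim

theorem mulVec_dotProduct_self_le (M : Matrix ι κ ℝ) (x : κ → ℝ) :
    M *ᵥ x ⬝ᵥ M *ᵥ x ≤ (∑ i, ∑ j, M i j ^ 2) * (x ⬝ᵥ x) := by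
  rw [Finset.sum_mul]
  refine Finset.sum_le_sum fun i _ => ?_
  have := Finset.sum_mul_sq_le_sq_mul_sq Finset.univ (M i) x
  simpa [mulVec, dotProduct, sq] using this

/-- A Hurwitz matrix admits a quadratic Lyapunov function, normalized to dominate `‖x‖²`. -/
theorem exists_lyapunov_of_hurwitz [DecidableEq ι] (A : Matrix ι ι ℝ)
    (hA : ∀ μ ∈ spectrum ℂ (A.map (Complex.ofReal : ℝ → ℂ)), μ.re < 0) :
    ∃ (P : Matrix ι ι ℝ) (ε : ℝ), P.PosSemidef ∧ 0 < ε ∧ (∀ x, x ⬝ᵥ x ≤ x ⬝ᵥ P *ᵥ x) ∧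
      ∀ x, x ⬝ᵥ (Aᵀ * P + P * A) *ᵥ x ≤ -ε * (x ⬝ᵥ x) := by
  obtain ⟨h, hpos, hlim⟩ := exists_pos_tendsto_one_add_smul_pow A hA
  set B := 1 + h • A with hB
  have hcont : Continuous fun M : Matrix ι ι ℝ => ∑ i, ∑ j, M i j ^ 2 := by fun_prop
  obtain ⟨N, hN⟩ := (((hcont.tendsto 0).comp hlim).eventually_lt_const
    (show _ < (1 : ℝ) by simp)).and (eventually_ge_atTop 1) |>.exists
  obtain ⟨hN, hN1⟩ := hN
  dsimp only [Function.comp_apply] at hN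
  have hpsd (k : ℕ) : ((B ^ k)ᵀ * B ^ k).PosSemidef := by
    simpa using posSemidef_conjTranspose_mul_self (B ^ k)
  have hquad (M : Matrix ι ι ℝ) (x : ι → ℝ) : x ⬝ᵥ (Mᵀ * M) *ᵥ x = M *ᵥ x ⬝ᵥ M *ᵥ x := by
    rw [← mulVec_mulVec, dotProduct_mulVec, vecMul_transpose]
  set P := ∑ k ∈ Finset.range N, (B ^ k)ᵀ * B ^ k with hP
  have hPpsd : P.PosSemidef := posSemidef_sum _ fun k _ => hpsd k
  have hstein : h • (Aᵀ * P + P * A) = (B ^ N)ᵀ * B ^ N - 1 - (h * h) • (Aᵀ * P * A) := by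
    have h1 : Bᵀ * P * B - P = (B ^ N)ᵀ * B ^ N - 1 := by
      have h2 := Finset.sum_range_sub (fun k => (B ^ k)ᵀ * B ^ k) N
      rw [Finset.sum_sub_distrib] at h2
      simp only [pow_zero, transpose_one, mul_one] at h2
      rw [← h2, hP, Finset.mul_sum, Finset.sum_mul]
      congr 1
      refine Finset.sum_congr rfl fun k _ => ?_
      simp only [pow_succ, transpose_mul, Matrix.mul_assoc]
    rw [← h1, hB, transpose_add, transpose_one, transpose_smul]
    simp only [add_mul, mul_add, one_mul, mul_one, smul_mul_assoc, mul_smul_comm, smul_add,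
      mul_smul]
    abel
  refine ⟨P, (1 - ∑ i, ∑ j, (B ^ N) i j ^ 2) / h, hPpsd, div_pos (by linarith) hpos, ?_, ?_⟩
  · intro x
    rw [hP, sum_mulVec, dotProduct_sum]
    simp only [hquad]
    refine le_trans (by simp) (Finset.single_le_sum (f := fun k => B ^ k *ᵥ x ⬝ᵥ B ^ k *ᵥ x)
      (fun k _ => ?_) (Finset.mem_range.2 hN1))
    exact Finset.sum_nonneg fun i _ => mul_self_nonneg _
  · intro x
    have h1 := congrArg (fun M : Matrix ι ι ℝ => x ⬝ᵥ M *ᵥ x) hstein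
    simp only [smul_mulVec, sub_mulVec, dotProduct_smul, dotProduct_sub, hquad, one_mulVec,
      smul_eq_mul] at h1
    have h2 : 0 ≤ x ⬝ᵥ (Aᵀ * P * A) *ᵥ x := by
      simpa using (hPpsd.conjTranspose_mul_mul_same A).dotProduct_mulVec_nonneg x
    have h3 := mulVec_dotProduct_self_le (B ^ N) x
    have h4 := mul_nonneg (mul_self_nonneg h) h2
    rw [neg_mul, div_mul_eq_mul_div, ← neg_div, le_div_iff₀ hpos]
    linarith

theorem two_mul_dotProduct_le {c : ℝ} (hc : 0 < c) (x y : ι → ℝ) :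
    2 * (x ⬝ᵥ y) ≤ c * (x ⬝ᵥ x) + c⁻¹ * (y ⬝ᵥ y) := by
  simp only [dotProduct, Finset.mul_sum, ← Finset.sum_add_distrib]
  refine Finset.sum_le_sum fun i _ => ?_
  have : c * (x i * x i) + c⁻¹ * (y i * y i) - 2 * (x i * y i) = c * (x i - c⁻¹ * y i) ^ 2 := by
    field_simp
    ring
  linarith [mul_nonneg hc.le (sq_nonneg (x i - c⁻¹ * y i))]

theorem dotProduct_fromBlocks_mulVec (Q : Matrix ι ι ℝ) (R : Matrix ι κ ℝ) (S : Matrix κ κ ℝ)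
    (v : ι ⊕ κ → ℝ) :
    v ⬝ᵥ fromBlocks Q R Rᵀ S *ᵥ v =
      (v ∘ Sum.inl) ⬝ᵥ Q *ᵥ (v ∘ Sum.inl) + 2 * ((v ∘ Sum.inl) ⬝ᵥ R *ᵥ (v ∘ Sum.inr)) +
        (v ∘ Sum.inr) ⬝ᵥ S *ᵥ (v ∘ Sum.inr) := by
  have h : (v ∘ Sum.inr) ⬝ᵥ Rᵀ *ᵥ (v ∘ Sum.inl) = (v ∘ Sum.inl) ⬝ᵥ R *ᵥ (v ∘ Sum.inr) := by
    rw [dotProduct_comm, dotProduct_mulVec, mulVec_transpose]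
  rw [fromBlocks_mulVec, dotProduct_block]
  simp only [Sum.elim_comp_inl, Sum.elim_comp_inr, dotProduct_add, h]
  ring

end Matrix

/-- **Feasibility of the peak-to-peak LMI problem for Hurwitz matrices
(claim after Problem (11)).**
If `A` is Hurwitz (all complex eigenvalues have negative real part), then for any
`Bₑ` and `C` there exist `λ > 0`, `γ > 0` and a symmetric positive semidefinite `P`
such that `[[λP + AᵀP + PA, P Bₑ], [Bₑᵀ P, −γ I]] ⪯ 0` (negative semidefinite,
i.e. `vᵀ M v ≤ 0` for all `v`) and `[[γ I, C], [Cᵀ, λ P]] ⪰ 0`. -/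
theorem peak_LMI_feasible_of_hurwitz
    {n m p : ℕ}
    (A : Matrix (Fin n) (Fin n) ℝ)
    (hA : ∀ μ ∈ spectrum ℂ (A.map (Complex.ofReal : ℝ → ℂ)), μ.re < 0)
    (Be : Matrix (Fin n) (Fin m) ℝ) (C : Matrix (Fin p) (Fin n) ℝ) :
    ∃ (lam gam : ℝ) (P : Matrix (Fin n) (Fin n) ℝ),
      0 < lam ∧ 0 < gam ∧ P.PosSemidef ∧
      (∀ v : Fin n ⊕ Fin m → ℝ,
        v ⬝ᵥ ((Matrix.fromBlocks
          (lam • P + Aᵀ * P + P * A) (P * Be)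
          (Beᵀ * P) (-(gam • (1 : Matrix (Fin m) (Fin m) ℝ)))) *ᵥ v) ≤ 0) ∧
      (Matrix.fromBlocks
        (gam • (1 : Matrix (Fin p) (Fin p) ℝ)) C Cᵀ (lam • P)).PosSemidef := by
  obtain ⟨P, ε, hP, hε, hlow, hlyap⟩ := exists_lyapunov_of_hurwitz A hA
  have hnn {k : ℕ} (x : Fin k → ℝ) : 0 ≤ x ⬝ᵥ x := Finset.sum_nonneg fun i _ => mul_self_nonneg _
  set cP := ∑ i, ∑ j, P i j ^ 2
  set cB := ∑ i, ∑ j, (P * Be) i j ^ 2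
  set cC := ∑ i, ∑ j, Cᵀ i j ^ 2
  have hcP : 0 ≤ cP := by positivity
  have hcB : 0 ≤ cB := by positivity
  have hcC : 0 ≤ cC := by positivity
  have hPs : Pᵀ = P := by simpa using hP.1.eq
  set lam := ε / (1 + cP) with hlam
  have hlampos : 0 < lam := by positivity
  have hgam : 0 < (ε / 2)⁻¹ * cB + lam⁻¹ * cC + 1 := by positivity
  refine ⟨lam, (ε / 2)⁻¹ * cB + lam⁻¹ * cC + 1, P, hlampos, hgam, hP, fun v => ?_,
    .of_dotProduct_mulVec_nonneg ?_ fun v => ?_⟩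
  · rw [show Beᵀ * P = (P * Be)ᵀ by rw [transpose_mul, hPs], dotProduct_fromBlocks_mulVec]
    set x := v ∘ Sum.inl
    set w := v ∘ Sum.inr
    have hup : lam * (x ⬝ᵥ P *ᵥ x) ≤ ε / 2 * (x ⬝ᵥ x) := by
      have h1 := two_mul_dotProduct_le one_pos x (P *ᵥ x)
      have h2 : x ⬝ᵥ P *ᵥ x ≤ (1 + cP) / 2 * (x ⬝ᵥ x) := by
        linarith [mulVec_dotProduct_self_le P x]
      calc lam * (x ⬝ᵥ P *ᵥ x) ≤ lam * ((1 + cP) / 2 * (x ⬝ᵥ x)) := by gcongr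
        _ = ε / 2 * (x ⬝ᵥ x) := by rw [hlam]; field_simp
    have hcross := two_mul_dotProduct_le (half_pos hε) x ((P * Be) *ᵥ w)
    have hbd := mul_le_mul_of_nonneg_left (mulVec_dotProduct_self_le (P * Be) w)
      (inv_pos.2 (half_pos hε)).le
    have hrest : 0 ≤ (lam⁻¹ * cC + 1) * (w ⬝ᵥ w) := mul_nonneg (by positivity) (hnn w)
    have hl := hlyap x
    simp only [add_assoc, add_mulVec _ (Aᵀ * P + P * A), smul_mulVec, neg_mulVec, one_mulVec,
      dotProduct_add, dotProduct_smul, dotProduct_neg, smul_eq_mul] at hl ⊢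
    linarith
  · refine IsHermitian.fromBlocks (by simp [IsHermitian]) (by simp) ?_
    simp [IsHermitian, hPs]
  · rw [star_trivial, dotProduct_fromBlocks_mulVec]
    set y := v ∘ Sum.inl
    set x := v ∘ Sum.inr
    have hswap : y ⬝ᵥ C *ᵥ x = x ⬝ᵥ Cᵀ *ᵥ y := by
      rw [dotProduct_comm x, dotProduct_mulVec, mulVec_transpose]
    have hcross := two_mul_dotProduct_le hlampos (-x) (Cᵀ *ᵥ y)
    have hbd := mul_le_mul_of_nonneg_left (mulVec_dotProduct_self_le Cᵀ y) (inv_pos.2 hlampos).le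
    have hrest : 0 ≤ ((ε / 2)⁻¹ * cB + 1) * (y ⬝ᵥ y) := mul_nonneg (by positivity) (hnn y)
    have hl := mul_le_mul_of_nonneg_left (hlow x) hlampos.le
    simp only [neg_dotProduct, dotProduct_neg, neg_neg] at hcross
    simp only [hswap, smul_mulVec, one_mulVec, dotProduct_smul, smul_eq_mul]
    linarith
end
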